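/- Let α be a nonzero real number and let u : ℝ × ℝ → ℝ be twice continuously differentiable on ℝ × (0,∞) and satisfy the equivariant Faddeev equation there. Suppose there exist real numbers 0 < a < b such that ∂ₜu(t,r) = 0 whenever r ∉ [a,b], and suppose the function r ↦ (1/2)·r·( A₁(0,r)·((∂ₜu(0,r))² + (∂ᵣu(0,r))²) + r⁻²sin²u(0,r) ) is integrable on (0,∞). Then for every t ∈ ℝ, the function r ↦ (1/2)·r·( A₁(t,r)·((∂ₜu(t,r))² + (∂ᵣu(t,r))²) + r⁻²sin²u(t,r) ) is integrable on (0,∞) and its integral Eu(t) equals Eu(0); that is, the energy is conserved. -/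

import Mathlib

open MeasureTheory

/-- Partial derivative in the first (time) variable. -/
noncomputable def pdt (w : ℝ × ℝ → ℝ) : ℝ × ℝ → ℝ :=
  fun p => deriv (fun t => w (t, p.2)) p.1

/-- Partial derivative in the second (radial) variable. -/
noncomputable def pdr (w : ℝ × ℝ → ℝ) : ℝ × ℝ → ℝ :=
  fun p => deriv (fun r => w (p.1, r)) p.2

lemma hasDerivAt_time_slice {f : ℝ × ℝ → ℝ} {p : ℝ × ℝ} (hf : DifferentiableAt ℝ f p) :
    HasDerivAt (fun t => f (t, p.2)) (fderiv ℝ f p (1, 0)) p.1 :=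
  HasFDerivAt.comp_hasDerivAt p.1 (f := fun t => (t, p.2)) hf.hasFDerivAt
    ((hasDerivAt_id p.1).prodMk (hasDerivAt_const p.1 p.2))

lemma hasDerivAt_radial_slice {f : ℝ × ℝ → ℝ} {p : ℝ × ℝ} (hf : DifferentiableAt ℝ f p) :
    HasDerivAt (fun r => f (p.1, r)) (fderiv ℝ f p (0, 1)) p.2 :=
  HasFDerivAt.comp_hasDerivAt p.2 (f := fun r => (p.1, r)) hf.hasFDerivAt
    ((hasDerivAt_const p.2 p.1).prodMk (hasDerivAt_id p.2))

lemma pdt_eq_fderiv {f : ℝ × ℝ → ℝ} {p : ℝ × ℝ} (hf : DifferentiableAt ℝ f p) :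
    pdt f p = fderiv ℝ f p (1, 0) :=
  (hasDerivAt_time_slice hf).deriv

lemma pdr_eq_fderiv {f : ℝ × ℝ → ℝ} {p : ℝ × ℝ} (hf : DifferentiableAt ℝ f p) :
    pdr f p = fderiv ℝ f p (0, 1) :=
  (hasDerivAt_radial_slice hf).deriv

lemma contDiffOn_pdt {f : ℝ × ℝ → ℝ} {U : Set (ℝ × ℝ)} (hU : IsOpen U)
    (hf : ContDiffOn ℝ 2 f U) : ContDiffOn ℝ 1 (pdt f) U := by
  have h : ContDiffOn ℝ 1 (fun p => fderiv ℝ f p (1, 0)) U :=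
    (hf.fderiv_of_isOpen hU (by norm_num)).clm_apply contDiffOn_const
  exact h.congr fun p hp =>
    pdt_eq_fderiv ((hf.differentiableOn (by norm_num)).differentiableAt (hU.mem_nhds hp))

lemma contDiffOn_pdr {f : ℝ × ℝ → ℝ} {U : Set (ℝ × ℝ)} (hU : IsOpen U)
    (hf : ContDiffOn ℝ 2 f U) : ContDiffOn ℝ 1 (pdr f) U := by
  have h : ContDiffOn ℝ 1 (fun p => fderiv ℝ f p (0, 1)) U :=
    (hf.fderiv_of_isOpen hU (by norm_num)).clm_apply contDiffOn_const
  exact h.congr fun p hp =>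
    pdr_eq_fderiv ((hf.differentiableOn (by norm_num)).differentiableAt (hU.mem_nhds hp))

lemma pdr_pdt_comm {f : ℝ × ℝ → ℝ} {U : Set (ℝ × ℝ)} (hU : IsOpen U)
    (hf : ContDiffOn ℝ 2 f U) {p : ℝ × ℝ} (hp : p ∈ U) :
    pdr (pdt f) p = pdt (pdr f) p := by
  have hd : ∀ q ∈ U, DifferentiableAt ℝ f q := fun q hq =>
    (hf.differentiableOn (by norm_num)).differentiableAt (hU.mem_nhds hq)
  have hd2 : DifferentiableAt ℝ (fderiv ℝ f) p :=
    ((hf.fderiv_of_isOpen hU (m := 1) (by norm_num)).differentiableOn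
      (by norm_num)).differentiableAt (hU.mem_nhds hp)
  have hv : DifferentiableAt ℝ (pdt f) p :=
    ((contDiffOn_pdt hU hf).differentiableOn (by norm_num)).differentiableAt (hU.mem_nhds hp)
  have hw : DifferentiableAt ℝ (pdr f) p :=
    ((contDiffOn_pdr hU hf).differentiableOn (by norm_num)).differentiableAt (hU.mem_nhds hp)
  have ev : pdt f =ᶠ[nhds p] fun q => fderiv ℝ f q (1, 0) := by
    filter_upwards [hU.mem_nhds hp] with q hq using pdt_eq_fderiv (hd q hq)
  have ew : pdr f =ᶠ[nhds p] fun q => fderiv ℝ f q (0, 1) := by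
    filter_upwards [hU.mem_nhds hp] with q hq using pdr_eq_fderiv (hd q hq)
  have hsymm : IsSymmSndFDerivAt ℝ f p :=
    (hf.contDiffAt (hU.mem_nhds hp)).isSymmSndFDerivAt (by simp)
  rw [pdr_eq_fderiv hv, pdt_eq_fderiv hw, ev.fderiv_eq, ew.fderiv_eq,
    fderiv_clm_apply hd2 (differentiableAt_const _),
    fderiv_clm_apply hd2 (differentiableAt_const _)]
  simpa using hsymm (0, 1) (1, 0)

/-- A function that does not vary in time off `[a, b]` is there determined by its time-zero slice. -/
lemma eq_time_zero_of_pdt_eq_zero {u : ℝ × ℝ → ℝ} {r : ℝ}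
    (hu : ∀ t, DifferentiableAt ℝ u (t, r)) (h : ∀ t, pdt u (t, r) = 0) (t : ℝ) :
    u (t, r) = u (0, r) :=
  is_const_of_deriv_eq_zero (f := fun s => u (s, r))
    (fun s => (hasDerivAt_time_slice (hu s)).differentiableAt) (fun s => h s) t 0

/-- The local conservation law for the equivariant Faddeev equation: `∂ₜ` of the energy density
equals `∂ᵣ` of the energy flux. -/
lemma faddeev_local_conservation (α : ℝ) (u : ℝ × ℝ → ℝ)
    (hu : ContDiffOn ℝ 2 u {p : ℝ × ℝ | 0 < p.2})
    (A E F : ℝ × ℝ → ℝ) (hA : ∀ p : ℝ × ℝ, A p = 1 + α ^ 2 * Real.sin (u p) ^ 2 / p.2 ^ 2)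
    (hE : ∀ p : ℝ × ℝ, E p = (1 / 2) * p.2 * (A p * ((pdt u p) ^ 2 + (pdr u p) ^ 2)
      + Real.sin (u p) ^ 2 / p.2 ^ 2))
    (hF : ∀ p : ℝ × ℝ, F p = p.2 * (A p * (pdt u p * pdr u p)))
    (p : ℝ × ℝ) (hp : 0 < p.2)
    (heq : pdt (pdt u) p - pdr (pdr u) p - p.2⁻¹ * pdr u p
        = -2 * p.2⁻¹ * (1 - (A p)⁻¹) * pdr u p
          - (p.2 ^ 2)⁻¹ * (A p)⁻¹ * (α ^ 2 * ((pdt u p) ^ 2 - (pdr u p) ^ 2) + 1)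
            * Real.sin (u p) * Real.cos (u p)) :
    pdt E p = pdr F p := by
  have hU : IsOpen {p : ℝ × ℝ | 0 < p.2} := isOpen_lt continuous_const continuous_snd
  have hn := hU.mem_nhds hp
  have du := (hu.differentiableOn (by norm_num)).differentiableAt hn
  have dv := ((contDiffOn_pdt hU hu).differentiableOn (by norm_num)).differentiableAt hn
  have dw := ((contDiffOn_pdr hU hu).differentiableOn (by norm_num)).differentiableAt hn
  have hcomm := pdr_pdt_comm hU hu hp
  have ut := hasDerivAt_time_slice du
  have ur := hasDerivAt_radial_slice du
  have vt := hasDerivAt_time_slice dv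
  have vr := hasDerivAt_radial_slice dv
  have wt := hasDerivAt_time_slice dw
  have wr := hasDerivAt_radial_slice dw
  rw [← pdt_eq_fderiv du] at ut
  rw [← pdr_eq_fderiv du] at ur
  rw [← pdt_eq_fderiv dv] at vt
  rw [← pdr_eq_fderiv dv, hcomm] at vr
  rw [← pdt_eq_fderiv dw] at wt
  rw [← pdr_eq_fderiv dw] at wr
  have hr : p.2 ≠ 0 := hp.ne'
  have hApos : A p ≠ 0 := by
    rw [hA]
    positivity
  have hA' := hA p
  set v := pdt u p
  set w := pdr u p
  set m := pdt (pdr u) p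
  set vt' := pdt (pdt u) p
  set wr' := pdr (pdr u) p
  set r := p.2
  set s := Real.sin (u p)
  set c := Real.cos (u p)
  have At : HasDerivAt (fun t => A (t, r)) (α ^ 2 * (2 * s * (c * v)) / r ^ 2) p.1 := by
    simp only [hA]
    refine ((((ut.sin.pow 2).const_mul (α ^ 2)).div_const (r ^ 2)).const_add 1).congr_deriv ?_
    simp [s, c, r]
  have Ar : HasDerivAt (fun x => A (p.1, x))
      (α ^ 2 * (2 * s * (c * w)) / r ^ 2 - 2 * α ^ 2 * s ^ 2 / r ^ 3) r := by
    simp only [hA]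
    refine ((((ur.sin.pow 2).const_mul (α ^ 2)).div ((hasDerivAt_id r).pow 2)
      (pow_ne_zero 2 hr)).const_add 1).congr_deriv ?_
    have hr' : p.2 ≠ 0 := hr
    simp [s, c, r]
    field_simp
  have Et : HasDerivAt (fun t => E (t, r))
      ((1 / 2) * r * (α ^ 2 * (2 * s * (c * v)) / r ^ 2 * (v ^ 2 + w ^ 2)
        + A p * (2 * v * vt' + 2 * w * m) + 2 * s * (c * v) / r ^ 2)) p.1 := by
    simp only [hE]
    refine (((At.mul ((vt.pow 2).add (wt.pow 2))).add
      ((ut.sin.pow 2).div_const (r ^ 2))).const_mul ((1 / 2) * r)).congr_deriv ?_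
    simp [s, c, r, v, w]
  have Fr : HasDerivAt (fun x => F (p.1, x))
      (A p * (v * w) + r * ((α ^ 2 * (2 * s * (c * w)) / r ^ 2 - 2 * α ^ 2 * s ^ 2 / r ^ 3)
        * (v * w) + A p * (m * w + v * wr'))) r := by
    simp only [hF]
    refine ((hasDerivAt_id r).mul (Ar.mul (vr.mul wr))).congr_deriv ?_
    simp [r, v, w]
  rw [show pdt E p = _ from Et.deriv, show pdr F p = _ from Fr.deriv]
  have hvtt : vt' = wr' + r⁻¹ * w + (-2 * r⁻¹ * (1 - (A p)⁻¹) * w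
      - (r ^ 2)⁻¹ * (A p)⁻¹ * (α ^ 2 * (v ^ 2 - w ^ 2) + 1) * s * c) := by
    linarith
  have hs : α ^ 2 * s ^ 2 = r ^ 2 * (A p - 1) := by
    rw [hA']
    field_simp
    ring
  rw [mul_assoc 2 (α ^ 2), hs, hvtt]
  field_simp
  ring

/-- Conservation of energy for the equivariant Faddeev equation: if `u` is `C²` on
`ℝ × (0,∞)`, solves the equation there, `∂ₜu(t,·)` is supported in `[a,b] ⊆ (0,∞)`,
and the energy density is integrable at time `0`, then it is integrable at every time
and the energy `Eu(t) = ∫₀^∞ (1/2)r[A₁((∂ₜu)²+(∂ᵣu)²) + r⁻²sin²u] dr` is constant. -/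
theorem stmt6 (α : ℝ) (hα : α ≠ 0) (u : ℝ × ℝ → ℝ)
    (hu : ContDiffOn ℝ 2 u {p : ℝ × ℝ | 0 < p.2})
    (A₁ : ℝ × ℝ → ℝ) (hA₁ : ∀ p : ℝ × ℝ, A₁ p = 1 + α ^ 2 * Real.sin (u p) ^ 2 / p.2 ^ 2)
    (hFaddeev : ∀ p : ℝ × ℝ, 0 < p.2 →
      pdt (pdt u) p - pdr (pdr u) p - p.2⁻¹ * pdr u p
        = -2 * p.2⁻¹ * (1 - (A₁ p)⁻¹) * pdr u p
          - (p.2 ^ 2)⁻¹ * (A₁ p)⁻¹ * (α ^ 2 * ((pdt u p) ^ 2 - (pdr u p) ^ 2) + 1)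
            * Real.sin (u p) * Real.cos (u p))
    (a b : ℝ) (ha : 0 < a) (hab : a < b)
    (hsupp : ∀ t r : ℝ, r ∉ Set.Icc a b → pdt u (t, r) = 0)
    (e : ℝ → ℝ → ℝ)
    (he : ∀ t r : ℝ, e t r = (1 / 2) * r
      * (A₁ (t, r) * ((pdt u (t, r)) ^ 2 + (pdr u (t, r)) ^ 2)
          + Real.sin (u (t, r)) ^ 2 / r ^ 2))
    (hint0 : IntegrableOn (e 0) (Set.Ioi 0)) :
    ∀ t : ℝ, IntegrableOn (e t) (Set.Ioi 0) ∧
      ∫ r in Set.Ioi (0 : ℝ), e t r = ∫ r in Set.Ioi (0 : ℝ), e 0 r := by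
  intro t
  set U : Set (ℝ × ℝ) := {p : ℝ × ℝ | 0 < p.2} with hUdef
  have hU : IsOpen U := isOpen_lt continuous_const continuous_snd
  have hdu : ∀ p ∈ U, DifferentiableAt ℝ u p := fun p hp =>
    (hu.differentiableOn (by norm_num)).differentiableAt (hU.mem_nhds hp)
  set E : ℝ × ℝ → ℝ := fun p => e p.1 p.2 with hEdef
  set F : ℝ × ℝ → ℝ := fun p => p.2 * (A₁ p * (pdt u p * pdr u p)) with hFdef
  have hE : ∀ p : ℝ × ℝ, E p = (1 / 2) * p.2 * (A₁ p * ((pdt u p) ^ 2 + (pdr u p) ^ 2)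
      + Real.sin (u p) ^ 2 / p.2 ^ 2) := fun p => he p.1 p.2
  have hv := contDiffOn_pdt hU hu
  have hw := contDiffOn_pdr hU hu
  have hu1 : ContDiffOn ℝ 1 u U := hu.of_le (by norm_num)
  have hsnd : ContDiffOn ℝ 1 (fun p : ℝ × ℝ => p.2) U := contDiff_snd.contDiffOn
  have hne : ∀ p ∈ U, p.2 ^ 2 ≠ 0 := fun p hp => pow_ne_zero 2 (ne_of_gt hp)
  have hAC : ContDiffOn ℝ 1 A₁ U :=
    (contDiffOn_const.add ((contDiffOn_const.mul (hu1.sin.pow 2)).div (hsnd.pow 2) hne)).congr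
      fun p _ => hA₁ p
  have hEC : ContDiffOn ℝ 1 E U :=
    ((contDiffOn_const.mul hsnd).mul ((hAC.mul ((hv.pow 2).add (hw.pow 2))).add
      ((hu1.sin.pow 2).div (hsnd.pow 2) hne))).congr fun p _ => hE p
  have hFC : ContDiffOn ℝ 1 F U := hsnd.mul (hAC.mul (hv.mul hw))
  have hdE : ∀ p ∈ U, DifferentiableAt ℝ E p := fun p hp =>
    (hEC.differentiableOn (by norm_num)).differentiableAt (hU.mem_nhds hp)
  have hdF : ∀ p ∈ U, DifferentiableAt ℝ F p := fun p hp =>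
    (hFC.differentiableOn (by norm_num)).differentiableAt (hU.mem_nhds hp)
  have hconst : ∀ s r, 0 < r → r ∉ Set.Icc a b → u (s, r) = u (0, r) := fun s r hr hrab =>
    eq_time_zero_of_pdt_eq_zero (fun s => hdu (s, r) hr) (fun s => hsupp s r hrab) s
  have hoff : ∀ s r, 0 < r → r ∉ Set.Icc a b → e s r = e 0 r := by
    intro s r hr hrab
    have hw0 : pdr u (s, r) = pdr u (0, r) := by
      refine Filter.EventuallyEq.deriv_eq ?_
      filter_upwards [isClosed_Icc.isOpen_compl.mem_nhds hrab, lt_mem_nhds hr] with x hx hx0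
        using hconst s x hx0 hx
    rw [he, he, hA₁, hA₁, hsupp s r hrab, hsupp 0 r hrab, hw0, hconst s r hr hrab]
  have hcd : a / 2 ≤ b + 1 := by linarith
  have hsub : Set.Icc (a / 2) (b + 1) ⊆ Set.Ioi 0 := fun r hr =>
    lt_of_lt_of_le (by linarith) hr.1
  have hint : ∀ s, IntegrableOn (e s) (Set.Icc (a / 2) (b + 1)) := fun s =>
    ContinuousOn.integrableOn_Icc (hEC.continuousOn.comp (f := fun r => (s, r))
      (by fun_prop) fun r hr => hsub hr)
  have hdiff : ∀ r ∈ Set.Ioi (0 : ℝ) \ Set.Icc (a / 2) (b + 1), e t r - e 0 r = 0 := by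
    intro r hr
    refine sub_eq_zero.2 (hoff t r hr.1 fun h => hr.2 ⟨?_, ?_⟩)
    · linarith [h.1]
    · linarith [h.2]
  have hintd : IntegrableOn (fun r => e t r - e 0 r) (Set.Ioi 0) :=
    ((hint t).sub (hint 0)).of_forall_sdiff_eq_zero measurableSet_Ioi hdiff
  have hintt : IntegrableOn (e t) (Set.Ioi 0) := by
    exact (hintd.add hint0).congr_fun (fun r _ => by simp) measurableSet_Ioi
  refine ⟨hintt, ?_⟩
  rw [← sub_eq_zero, ← integral_sub hintt hint0,
    setIntegral_eq_of_subset_of_forall_sdiff_eq_zero measurableSet_Ioi hsub hdiff,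
    integral_sub (hint t) (hint 0), integral_Icc_eq_integral_Ioc, integral_Icc_eq_integral_Ioc,
    ← intervalIntegral.integral_of_le hcd, ← intervalIntegral.integral_of_le hcd]
  have hrect : ∀ p ∈ Set.uIcc 0 t ×ˢ Set.uIcc (a / 2) (b + 1), p ∈ U := by
    rintro p ⟨-, hp⟩
    rw [Set.uIcc_of_le hcd] at hp
    exact hsub hp
  have hdiv : ∀ p ∈ U, fderiv ℝ E p (1, 0) + (fun q => -fderiv ℝ F q) p (0, 1) = 0 := by
    intro p hp
    have h := faddeev_local_conservation α u hu A₁ E F hA₁ hE (fun _ => rfl) p hp (hFaddeev p hp)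
    rw [pdt_eq_fderiv (hdE p hp), pdr_eq_fderiv (hdF p hp)] at h
    simp [h]
  have hF0 : ∀ s r, r ∉ Set.Icc a b → F (s, r) = 0 := fun s r hr => by
    simp [hFdef, hsupp s r hr]
  have key := integral2_divergence_prod_of_hasFDerivAt_off_countable E (fun p => -F p)
    (fderiv ℝ E) (fun p => -fderiv ℝ F p) 0 (a / 2) t (b + 1) ∅ Set.countable_empty
    (hEC.continuousOn.mono hrect) (hFC.continuousOn.mono hrect).neg
    (fun p hp => (hdE p (hrect p ?_)).hasFDerivAt)
    (fun p hp => (hdF p (hrect p ?_)).hasFDerivAt.neg)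
    (integrableOn_zero.congr_fun (fun p hp => (hdiv p (hrect p hp)).symm)
      (measurableSet_uIcc.prod measurableSet_uIcc))
  · have hz : ∀ s ∈ Set.uIcc 0 t, (∫ r in (a / 2)..(b + 1),
        fderiv ℝ E (s, r) (1, 0) + (-fderiv ℝ F (s, r)) (0, 1)) = 0 := fun s hs => by
      rw [intervalIntegral.integral_congr (g := fun _ => (0 : ℝ))
        fun r hr => hdiv (s, r) (hrect (s, r) ⟨hs, hr⟩)]
      simp
    rw [intervalIntegral.integral_congr (g := fun _ => (0 : ℝ)) hz] at key
    simp only [hF0 _ (b + 1) (fun h => by linarith [h.2]),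
      hF0 _ (a / 2) (fun h => by linarith [h.1])] at key
    simpa [hEdef] using key.symm
  all_goals
    exact ⟨Set.Ioo_subset_Icc_self hp.1.1, Set.Ioo_subset_Icc_self hp.1.2⟩
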